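/- There is no simple graph G on exactly 10 vertices with two longest paths P and Q satisfying all of the following: V(G) = V(P) ∪ V(Q); |V(P) ∩ V(Q)| = 6; V(P) \ V(Q) = {a, b} where ab is an edge of P; V(Q) \ V(P) = {c, d} where cd is an edge of Q; ac is an edge of G; the subgraph of G induced on {a, b, c, d} is connected; and no endpoint of P lies in {a, b} and no endpoint of Q lies in {c, d}. -/

import Mathlib

open SimpleGraph

/-- `P` is a longest path in the simple graph `G`: it is a path, and every path in `G`
has length at most the length of `P`. -/
def IsLongestPath {V : Type*} (G : SimpleGraph V) {u v : V} (P : G.Walk u v) : Prop :=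
  P.IsPath ∧ ∀ {a b : V} (Q : G.Walk a b), Q.IsPath → Q.length ≤ P.length

/-- Whether some path with `n` edges starts at `x` and continues inside the list `l`, in the graph on
the natural numbers with adjacency test `adj`. -/
def searchPath (adj : ℕ → ℕ → Bool) : ℕ → ℕ → List ℕ → Bool
  | 0, _, _ => true
  | n + 1, x, l => l.any fun y => adj x y && searchPath adj n y (l.erase y)

theorem exists_path_of_searchPath {adj : ℕ → ℕ → Bool} {n x : ℕ} {l : List ℕ}
    (h : searchPath adj n x l = true) (hl : l.Nodup) (hx : x ∉ l) :
    ∃ l' : List ℕ, l' ⊆ l ∧ l'.length = n ∧ (x :: l').Nodup ∧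
      (x :: l').IsChain (fun y z => adj y z = true) := by
  induction n generalizing x l with
  | zero => exact ⟨[], by simp⟩
  | succ n ih =>
    simp only [searchPath, List.any_eq_true, Bool.and_eq_true] at h
    obtain ⟨y, hyl, hxy, hy⟩ := h
    obtain ⟨l', hsub, hlen, hnd, hch⟩ := ih hy (hl.erase y) hl.not_mem_erase
    have hsub' : y :: l' ⊆ l := List.cons_subset.2
      ⟨hyl, fun _ hm => List.erase_subset (hsub hm)⟩
    exact ⟨y :: l', hsub', by simp [hlen], List.nodup_cons.2 ⟨fun hm => hx (hsub' hm), hnd⟩,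
      List.isChain_cons_cons.2 ⟨hxy, hch⟩⟩

/-- The edges of the path `0, 1, …, 7` together with the edges joining `8` to `i` and `z`, and `9`
to `8` and `w`, each in one direction. -/
def pathWithDetourArc (i z w x y : ℕ) : Bool :=
  (x + 1 == y && y < 8) || (x == 8 && (y == i || y == z || y == 9)) || (x == 9 && y == w)

set_option synthInstance.maxSize 1000 in
theorem searchPath_pathWithDetourArc : ∀ i < 6, ∀ z < 8, ∀ w < 8,
    1 ≤ i ∧ z ≠ w ∧ z ≠ i ∧ z ≠ i + 1 ∧ w ≠ i ∧ w ≠ i + 1 →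
    (searchPath (fun x y => pathWithDetourArc i z w x y || pathWithDetourArc i z w y x) 8 0
        [1, 2, 3, 4, 5, 6, 7, 8, 9] ||
      searchPath (fun x y => pathWithDetourArc i z w x y || pathWithDetourArc i z w y x) 8 7
        [0, 1, 2, 3, 4, 5, 6, 8, 9]) = true := by
  decide +kernel

/-- A graph containing a path on eight vertices, with two consecutive interior vertices `p i` and
`p (i + 1)`, and a further edge `cd` with `c` adjacent to `p i`, such that `c` and `d` have distinct
neighbours among the remaining vertices of the path, contains a path on nine vertices. -/
theorem exists_isChain_length_eq_nine {V : Type*} {G : SimpleGraph V} {p : List V} {c d : V}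
    (hlen : p.length = 8) (hnd : p.Nodup) (hp : p.IsChain G.Adj) (hc : c ∉ p) (hd : d ∉ p)
    (hcd : G.Adj c d) {i z w : ℕ} (hi : 1 ≤ i) (hi' : i < 6) (hz : z < 8) (hw : w < 8)
    (hzw : z ≠ w) (hzi : z ≠ i) (hzi' : z ≠ i + 1) (hwi : w ≠ i) (hwi' : w ≠ i + 1)
    (hic : G.Adj p[i] c) (hcz : G.Adj p[z] c) (hdw : G.Adj p[w] d) :
    ∃ l : List V, l.length = 9 ∧ l.Nodup ∧ l.IsChain G.Adj := by
  set q := p ++ [c, d] with hq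
  have hqlen : q.length = 10 := by simp [hq, hlen]
  have hqnd : q.Nodup := by
    have := hcd.ne
    simp only [hq, List.nodup_append]
    grind
  let f : ℕ → V := fun n => q.getD n c
  have hf : ∀ n (h : n < 10), f n = q[n] := fun n h =>
    List.getD_eq_getElem _ _ (by omega)
  have hfp : ∀ n (h : n < 8), f n = p[n] := fun n h => by
    rw [hf n (by omega)]; simp only [hq]; rw [List.getElem_append_left]
  have hf8 : f 8 = c := by rw [hf 8 (by omega)]; simp [hq, List.getElem_append_right, hlen]
  have hf9 : f 9 = d := by rw [hf 9 (by omega)]; simp [hq, List.getElem_append_right, hlen]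
  have harc : ∀ x y, pathWithDetourArc i z w x y = true → G.Adj (f x) (f y) := by
    intro x y h
    simp only [pathWithDetourArc, Bool.or_eq_true, Bool.and_eq_true, beq_iff_eq,
      decide_eq_true_eq] at h
    rcases h with (⟨rfl, h⟩ | ⟨rfl, (rfl | rfl) | rfl⟩) | ⟨rfl, rfl⟩
    · rw [hfp x (by omega), hfp (x + 1) h]
      exact List.isChain_iff_getElem.1 hp x (by omega)
    · rw [hf8, hfp y (by omega)]; exact hic.symm
    · rw [hf8, hfp y hz]; exact hcz.symm
    · rwa [hf8, hf9]
    · rw [hf9, hfp y hw]; exact hdw.symm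
  have key : ∀ l : List ℕ, l.length = 9 → (∀ n ∈ l, n < 10) → l.Nodup →
      l.IsChain (fun x y => (pathWithDetourArc i z w x y || pathWithDetourArc i z w y x) = true) →
      ∃ l : List V, l.length = 9 ∧ l.Nodup ∧ l.IsChain G.Adj := by
    intro l hl hb hn hch
    refine ⟨l.map f, by simp [hl], ?_, ?_⟩
    · refine (List.nodup_map_iff_inj_on hn).2 fun x hx y hy hxy => ?_
      rw [hf x (hb x hx), hf y (hb y hy)] at hxy
      exact (hqnd.getElem_inj_iff).1 hxy
    · refine (List.isChain_map f).2 (hch.imp fun x y h => ?_)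
      rcases Bool.or_eq_true_iff.1 h with h | h
      · exact harc x y h
      · exact (harc y x h).symm
  rcases Bool.or_eq_true_iff.1
    (searchPath_pathWithDetourArc i hi' z hz w hw ⟨hi, hzw, hzi, hzi', hwi, hwi'⟩) with h | h
  all_goals
    obtain ⟨l, hsub, hl, hn, hch⟩ := exists_path_of_searchPath h (by decide) (by decide)
    refine key _ (by simp [hl]) ?_ hn hch
    intro n hn
    rcases List.mem_cons.1 hn with rfl | hn
    · omega
    · have := hsub hn
      simp only [List.mem_cons, List.not_mem_nil, or_false] at this
      omega

theorem IsLongestPath.length_le_of_isChain {V : Type*} {G : SimpleGraph V} {u v : V}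
    {P : G.Walk u v} (hP : IsLongestPath G P) {l : List V} (hnd : l.Nodup)
    (hl : l.IsChain G.Adj) : l.length ≤ P.support.length := by
  by_cases hne : l = []
  · simp [hne]
  · have := hP.2 (Walk.ofSupport l hne hl)
      (by rw [Walk.isPath_def, Walk.support_ofSupport]; exact hnd)
    rw [Walk.length_ofSupport] at this
    rw [Walk.length_support]
    omega

theorem SimpleGraph.Walk.exists_support_eq_append_of_mem_edges {V : Type*} {G : SimpleGraph V}
    {u v a b : V} (P : G.Walk u v) (h : s(a, b) ∈ P.edges) :
    ∃ l₁ l₂ : List V, P.support = l₁ ++ a :: b :: l₂ ∨ P.support = l₁ ++ b :: a :: l₂ := by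
  induction P with
  | nil => simp at h
  | cons hadj P ih =>
    rw [Walk.edges_cons, List.mem_cons] at h
    rcases h with h | h
    · refine ⟨[], P.support.tail, ?_⟩
      rw [Walk.support_cons]
      rcases Sym2.eq_iff.1 h with ⟨rfl, rfl⟩ | ⟨rfl, rfl⟩
      · left; simp
      · right; simp
    · obtain ⟨l₁, l₂, h | h⟩ := ih h
      · exact ⟨_ :: l₁, l₂, .inl (by rw [Walk.support_cons, h]; rfl)⟩
      · exact ⟨_ :: l₁, l₂, .inr (by rw [Walk.support_cons, h]; rfl)⟩

/-- The vertices of a walk through an edge `ab` avoiding its ends can be listed, in the order of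
the walk or in the reverse order, so that `a` directly precedes `b`. -/
theorem SimpleGraph.Walk.exists_perm_support_eq_append {V : Type*} {G : SimpleGraph V}
    {u v a b : V} (P : G.Walk u v) (h : s(a, b) ∈ P.edges)
    (hu : u ∉ ({a, b} : Set V)) (hv : v ∉ ({a, b} : Set V)) :
    ∃ (l₁ l₂ : List V) (x y : V), (l₁ ++ x :: a :: b :: y :: l₂).Perm P.support ∧
      (l₁ ++ x :: a :: b :: y :: l₂).IsChain G.Adj := by
  simp only [Set.mem_insert_iff, Set.mem_singleton_iff, not_or] at hu hv
  obtain ⟨m₁, m₂, hm⟩ := P.exists_support_eq_append_of_mem_edges h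
  have hhead := P.head_support
  have hlast := P.getLast_support
  have hm₁ : m₁ ≠ [] := by
    rintro rfl
    rcases hm with hm | hm <;> simp [hm] at hhead <;> simp_all
  have hm₂ : m₂ ≠ [] := by
    rintro rfl
    rcases hm with hm | hm <;> simp [hm] at hlast <;> simp_all
  obtain ⟨l₁, x, rfl⟩ := List.eq_nil_or_concat m₁ |>.resolve_left hm₁
  obtain ⟨y, l₂, rfl⟩ := List.exists_cons_of_ne_nil hm₂
  have hch := P.isChain_adj_support
  rcases hm with hm | hm
  · refine ⟨l₁, l₂, x, y, ?_, ?_⟩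
    · rw [hm]; simp
    · rw [hm] at hch; simpa using hch
  · have hrev : l₂.reverse ++ y :: a :: b :: x :: l₁.reverse = P.support.reverse := by
      rw [hm]; simp
    refine ⟨l₂.reverse, l₁.reverse, y, x, ?_, ?_⟩
    · rw [hrev]; exact List.reverse_perm _
    · rw [hrev, List.isChain_reverse]
      exact hch.imp fun _ _ h => h.symm

theorem ncard_setOf_mem {α : Type*} {l : List α} (h : l.Nodup) : {x | x ∈ l}.ncard = l.length := by
  classical
  rw [← List.toFinset_card_of_nodup h, ← Set.ncard_coe_finset, List.coe_toFinset]

/-- Case 1: there is no simple graph on exactly 10 vertices with longest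
paths `P`, `Q` such that `V(G) = V(P) ∪ V(Q)`, `|V(P) ∩ V(Q)| = 6`,
`V(P) \ V(Q) = {a, b}` with `ab` an edge of `P`, `V(Q) \ V(P) = {c, d}` with `cd` an
edge of `Q`, `ac` an edge of `G`, the subgraph induced on `{a, b, c, d}` connected, and
no endpoint of `P` in `{a, b}` and no endpoint of `Q` in `{c, d}`. -/
theorem statement17 {V : Type*} [Fintype V] (G : SimpleGraph V)
    (hcard : Fintype.card V = 10)
    {u₁ v₁ u₂ v₂ : V} (P : G.Walk u₁ v₁) (Q : G.Walk u₂ v₂)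
    (hP : IsLongestPath G P) (hQ : IsLongestPath G Q)
    (hcover : {x | x ∈ P.support} ∪ {x | x ∈ Q.support} = Set.univ)
    (hint : ({x | x ∈ P.support} ∩ {x | x ∈ Q.support}).ncard = 6)
    (a b c d : V)
    (hab : {x | x ∈ P.support} \ {x | x ∈ Q.support} = {a, b})
    (habP : s(a, b) ∈ P.edges)
    (hcd : {x | x ∈ Q.support} \ {x | x ∈ P.support} = {c, d})
    (hcdQ : s(c, d) ∈ Q.edges)
    (hac : G.Adj a c)
    (hind : (G.induce ({a, b, c, d} : Set V)).Connected)
    (hPa : u₁ ∉ ({a, b} : Set V)) (hPb : v₁ ∉ ({a, b} : Set V))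
    (hQc : u₂ ∉ ({c, d} : Set V)) (hQd : v₂ ∉ ({c, d} : Set V)) :
    False := by
  obtain ⟨l₁, l₂, x, y, hperm, hch⟩ := P.exists_perm_support_eq_append habP hPa hPb
  obtain ⟨m₁, m₂, z, w, hqperm, hqch⟩ := Q.exists_perm_support_eq_append hcdQ hQc hQd
  have hPlen : P.support.length = 8 := by
    have hne : a ≠ b := (P.adj_of_mem_edges habP).ne
    rw [← ncard_setOf_mem hP.1.support_nodup, ← Set.ncard_inter_add_ncard_sdiff_eq_ncard
      {x | x ∈ P.support} {x | x ∈ Q.support} (List.finite_toSet _), hint, hab,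
      Set.ncard_pair hne]
  have hnd := hperm.nodup_iff.2 hP.1.support_nodup
  have hqnd := hqperm.nodup_iff.2 hQ.1.support_nodup
  have hnotMem : ∀ v ∈ ({c, d} : Set V), v ∉ l₁ ++ x :: a :: b :: y :: l₂ := by
    intro v hv
    rw [← hcd] at hv
    exact fun h => hv.2 (hperm.mem_iff.1 h)
  have hmem : ∀ v ∈ m₁ ++ z :: c :: d :: w :: m₂, v ≠ c → v ≠ d →
      v ∈ l₁ ++ x :: a :: b :: y :: l₂ := by
    intro v hv hvc hvd
    by_contra h
    have : v ∈ ({c, d} : Set V) := by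
      rw [← hcd]
      exact ⟨hqperm.mem_iff.1 hv, fun h' => h (hperm.mem_iff.2 h')⟩
    simp_all
  obtain ⟨hcz, hcd', hdw⟩ : G.Adj z c ∧ G.Adj c d ∧ G.Adj d w := by
    have := (List.isChain_append.1 hqch).2.1
    simp only [List.isChain_cons_cons] at this
    exact ⟨this.1, this.2.1, this.2.2.1⟩
  obtain ⟨hzc, hzd, hzw, hwc, hwd⟩ : z ≠ c ∧ z ≠ d ∧ z ≠ w ∧ w ≠ c ∧ w ≠ d := by
    have := (List.nodup_append.1 hqnd).2.1
    simp only [List.nodup_cons, List.mem_cons, not_or] at this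
    grind
  have hlen : (l₁ ++ x :: a :: b :: y :: l₂).length = 8 := hperm.length_eq.trans hPlen
  have ha : (l₁ ++ x :: a :: b :: y :: l₂)[l₁.length + 1]? = some a := by simp
  have hb : (l₁ ++ x :: a :: b :: y :: l₂)[l₁.length + 1 + 1]? = some b := by
    simp [add_assoc]
  have hi : l₁.length + 1 < 6 := by
    simp only [List.length_append, List.length_cons] at hlen
    omega
  have hab' : ∀ v ∈ m₁ ++ z :: c :: d :: w :: m₂, v ≠ a ∧ v ≠ b := by
    intro v hv
    have hv' : v ∉ ({a, b} : Set V) := by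
      rw [← hab]
      exact fun h => h.2 (hqperm.mem_iff.1 hv)
    simpa using hv'
  obtain ⟨hza, hzb⟩ := hab' z (by simp)
  obtain ⟨hwa, hwb⟩ := hab' w (by simp)
  obtain ⟨j, hj, hjz⟩ := List.getElem_of_mem (hmem z (by simp) hzc hzd)
  obtain ⟨k, hk, hkw⟩ := List.getElem_of_mem (hmem w (by simp) hwc hwd)
  generalize l₁ ++ x :: a :: b :: y :: l₂ = p at *
  generalize l₁.length = n at *
  obtain ⟨hn, rfl⟩ := List.getElem?_eq_some_iff.1 ha
  obtain ⟨hn', rfl⟩ := List.getElem?_eq_some_iff.1 hb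
  subst hjz hkw
  obtain ⟨l, hl, hlnd, hlch⟩ := exists_isChain_length_eq_nine (i := n + 1) (z := j) (w := k)
    hlen hnd hch (hnotMem c (by simp)) (hnotMem d (by simp)) hcd' (by omega) hi (hlen ▸ hj)
    (hlen ▸ hk) (by rintro rfl; exact hzw rfl) (by rintro rfl; exact hza rfl)
    (by rintro rfl; exact hzb rfl) (by rintro rfl; exact hwa rfl) (by rintro rfl; exact hwb rfl)
    hac hcz hdw.symm
  have := hP.length_le_of_isChain hlnd hlch
  omega
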